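/- arXiv:2402.09713 — 3 statements merged into one kernel-verified Lean document; each statement's English description precedes it below -/
import Mathlib

section
/- Let m, n be positive integers and ρ a faithful positive linear functional on M_n(ℂ). For every r > 0, the set C_r = { x = (x_l)_{l≥0} ∈ K_{m,ρ} : Tr(x_0) ≤ r } is a compact subset of the product space ∏_{l≥0} M_m(ℂ)⊗M_n(ℂ)^{⊗l} (with the product topology of entrywise convergence). (Key claim in the proof of Lemma 3.1, showing C_r is a cap of K_{m,ρ}.) -/
open scoped ComplexOrder

namespace DeFinetti

/-- `M_m(ℂ) ⊗ M_n(ℂ)^{⊗ l}`, realized as complex matrices indexed by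
`Fin m × (Fin l → Fin n)`. -/
abbrev Mat (m n l : ℕ) : Type :=
  Matrix (Fin m × (Fin l → Fin n)) (Fin m × (Fin l → Fin n)) ℂ

/-- Invariance under the action of `S_l` simultaneously permuting the `l`
tensor-factor positions of row and column indices. -/
def SymInvariant {m n l : ℕ} (x : Mat m n l) : Prop :=
  ∀ σ : Equiv.Perm (Fin l), ∀ p q : Fin m, ∀ i j : Fin l → Fin n,
    x (p, i ∘ σ) (q, j ∘ σ) = x (p, i) (q, j)

/-- The slice map `id_m ⊗ id_n^{⊗l} ⊗ ν` applying the functional `ν` to the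
last tensor factor. -/
def sliceMap {m n l : ℕ} (ν : Matrix (Fin n) (Fin n) ℂ →ₗ[ℂ] ℂ)
    (y : Mat m n (l + 1)) : Mat m n l :=
  fun pi qj =>
    ν (Matrix.of fun s t => y (pi.1, Fin.snoc pi.2 s) (qj.1, Fin.snoc qj.2 t))

/-- A positive linear functional on `M_n(ℂ)`. -/
def IsPosLF {n : ℕ} (ρ : Matrix (Fin n) (Fin n) ℂ →ₗ[ℂ] ℂ) : Prop :=
  ∀ x : Matrix (Fin n) (Fin n) ℂ, x.PosSemidef → 0 ≤ ρ x

/-- A faithful positive linear functional on `M_n(ℂ)`. -/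
def IsFaithfulPosLF {n : ℕ} (ρ : Matrix (Fin n) (Fin n) ℂ →ₗ[ℂ] ℂ) : Prop :=
  IsPosLF ρ ∧ ∀ x : Matrix (Fin n) (Fin n) ℂ, x.PosSemidef → x ≠ 0 → 0 < ρ x

/-- The convex cone `K_{m,ρ}` of sub-martingale sequences of symmetric quantum
states. -/
def Kcone (m n : ℕ) (ρ : Matrix (Fin n) (Fin n) ℂ →ₗ[ℂ] ℂ) :
    Set (∀ l : ℕ, Mat m n l) :=
  { x | (∀ l, (x l).PosSemidef) ∧ (∀ l, SymInvariant (x l)) ∧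
        ∀ l, (x l - sliceMap ρ (x (l + 1))).PosSemidef }

section ExtremeRays

variable {E : Type*} [AddCommGroup E] [Module ℝ E]

/-- `x` lies on the ray `ℝ≥0 • v`. -/
def OnRay (v x : E) : Prop := ∃ r : ℝ, 0 ≤ r ∧ x = r • v

/-- `v` generates an extreme ray of the convex cone `K`. -/
def IsExtremeRayGen (K : Set E) (v : E) : Prop :=
  v ∈ K ∧ v ≠ 0 ∧
    ∀ x : E, OnRay v x → x ≠ 0 →
      ∀ y ∈ K, ∀ z ∈ K, ∀ t : ℝ, 0 < t → t < 1 →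
        x = t • y + (1 - t) • z → OnRay v y ∧ OnRay v z

/-- `exr K`: the union of the extreme rays of `K`. -/
def exr (K : Set E) : Set E := { x | ∃ v : E, IsExtremeRayGen K v ∧ OnRay v x }

end ExtremeRays

/-- The Kronecker product `a ⊗ b^{⊗ l}`. -/
def kronPow {m n : ℕ} (a : Matrix (Fin m) (Fin m) ℂ) (b : Matrix (Fin n) (Fin n) ℂ)
    (l : ℕ) : Mat m n l :=
  fun pi qj => a pi.1 qj.1 * ∏ k : Fin l, b (pi.2 k) (qj.2 k)

/-- The tensor power functional `ρ^{⊗ k}`, obtained by iterating the slice of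
the last factor. -/
def powFun {n : ℕ} (ρ : Matrix (Fin n) (Fin n) ℂ →ₗ[ℂ] ℂ) :
    (k : ℕ) → Matrix (Fin k → Fin n) (Fin k → Fin n) ℂ → ℂ
  | 0, z => z (fun i => i.elim0) (fun i => i.elim0)
  | k + 1, z => powFun ρ k (Matrix.of fun i j =>
      ρ (Matrix.of fun s t => z (Fin.snoc i s) (Fin.snoc j t)))

/-- `(id_m ⊗ id_n ⊗ ρ^{⊗ k})(y)` for `y ∈ M_m(ℂ) ⊗ M_n(ℂ)^{⊗ (k+1)}`,
applying `ρ^{⊗ k}` to the last `k` tensor factors. -/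
def subSlice {m n : ℕ} (ρ : Matrix (Fin n) (Fin n) ℂ →ₗ[ℂ] ℂ) {k : ℕ}
    (y : Mat m n (k + 1)) : Matrix (Fin m × Fin n) (Fin m × Fin n) ℂ :=
  fun ps qt => powFun ρ k (Matrix.of fun i j =>
    y (ps.1, Fin.cons ps.2 i) (qt.1, Fin.cons qt.2 j))

/-- `y` is an `(k+1)`-sub-extension of `a` with respect to `ρ`. -/
def IsSubExtension {m n : ℕ} (ρ : Matrix (Fin n) (Fin n) ℂ →ₗ[ℂ] ℂ)
    (a : Matrix (Fin m × Fin n) (Fin m × Fin n) ℂ) {k : ℕ}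
    (y : Mat m n (k + 1)) : Prop :=
  y.PosSemidef ∧ SymInvariant y ∧ (a - subSlice ρ y).PosSemidef

/-- Separability: `a` is a finite sum of Kronecker products of positive
semidefinite matrices. -/
def IsSeparable {m n : ℕ} (a : Matrix (Fin m × Fin n) (Fin m × Fin n) ℂ) : Prop :=
  ∃ (N : ℕ) (b : Fin N → Matrix (Fin m) (Fin m) ℂ)
    (c : Fin N → Matrix (Fin n) (Fin n) ℂ),
    (∀ i, (b i).PosSemidef) ∧ (∀ i, (c i).PosSemidef) ∧
    a = ∑ i, Matrix.kroneckerMap (· * ·) (b i) (c i)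


section Compactness

variable {ι : Type*} [Fintype ι]

theorem isClosed_posSemidef : IsClosed {A : Matrix ι ι ℂ | A.PosSemidef} := by
  simp only [Matrix.posSemidef_iff_dotProduct_mulVec, Set.ofPred_and, Set.ofPred_forall]
  refine IsClosed.inter ?_ (isClosed_iInter fun v => ?_)
  · exact isClosed_eq (by fun_prop) continuous_id
  · exact isClosed_le continuous_const (by fun_prop)

theorem diag_re_le_trace_re {A : Matrix ι ι ℂ} (hA : A.PosSemidef) (i : ι) :
    (A i i).re ≤ A.trace.re := by
  rw [Matrix.trace, Complex.re_sum]
  exact Finset.single_le_sum (f := fun j => (A j j).re)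
    (fun j _ => (Complex.le_def.1 hA.diag_nonneg).1) (Finset.mem_univ i)

theorem norm_apply_le_trace_re {A : Matrix ι ι ℂ} (hA : A.PosSemidef) (i j : ι) :
    ‖A i j‖ ≤ A.trace.re := by
  have hdet := (hA.submatrix ![i, j]).det_nonneg
  have hji : A j i = star (A i j) := (hA.1.apply j i).symm
  have him (k : ι) : (A k k).im = 0 := (Complex.le_def.1 (hA.diag_nonneg (i := k))).2.symm
  have hre (k : ι) : 0 ≤ (A k k).re := (Complex.le_def.1 (hA.diag_nonneg (i := k))).1
  have h := (Complex.le_def.1 hdet).1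
  simp only [Matrix.det_fin_two, Matrix.submatrix_apply, Matrix.cons_val_zero,
    Matrix.cons_val_one, hji, Complex.sub_re, Complex.mul_re, him, Complex.zero_re,
    Complex.star_def, Complex.conj_re, Complex.conj_im] at h
  have hi := diag_re_le_trace_re hA i
  have hj := diag_re_le_trace_re hA j
  refine abs_le_of_sq_le_sq' ?_ ((hre i).trans hi) |>.2
  rw [← Complex.normSq_eq_norm_sq, Complex.normSq_apply]
  nlinarith [mul_le_mul hi hj (hre j) ((hre i).trans hi)]

theorem isCompact_posSemidef_trace_le (R : ℝ) :
    IsCompact {A : Matrix ι ι ℂ | A.PosSemidef ∧ A.trace.re ≤ R} := by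
  have hbox : IsCompact (Set.univ.pi fun _ : ι => Set.univ.pi fun _ : ι =>
      Metric.closedBall (0 : ℂ) R) :=
    isCompact_univ_pi fun _ => isCompact_univ_pi fun _ => isCompact_closedBall _ _
  refine hbox.of_isClosed_subset ?_ fun A hA i _ j _ => ?_
  · have htr : Continuous fun A : Matrix ι ι ℂ => A.trace.re :=
      Complex.continuous_re.comp (by fun_prop)
    have hle : IsClosed {A : Matrix ι ι ℂ | A.trace.re ≤ R} := isClosed_le htr continuous_const
    exact isClosed_posSemidef.inter hle
  · exact mem_closedBall_zero_iff.2 ((norm_apply_le_trace_re hA.1 i j).trans hA.2)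

end Compactness

theorem IsFaithfulPosLF.exists_mul_trace_le {n : ℕ} {ρ : Matrix (Fin n) (Fin n) ℂ →ₗ[ℂ] ℂ}
    (hρ : IsFaithfulPosLF ρ) :
    ∃ c : ℝ, 0 < c ∧ ∀ A : Matrix (Fin n) (Fin n) ℂ, A.PosSemidef →
      c * A.trace.re ≤ (ρ A).re := by
  have htr : Continuous fun A : Matrix (Fin n) (Fin n) ℂ => A.trace.re :=
    Complex.continuous_re.comp (by fun_prop)
  have hT : IsCompact {A : Matrix (Fin n) (Fin n) ℂ |
      (A.PosSemidef ∧ A.trace.re ≤ 1) ∧ A.trace.re = 1} :=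
    (isCompact_posSemidef_trace_le 1).inter_right (isClosed_eq htr continuous_const)
  have hcont : Continuous fun A => (ρ A).re :=
    Complex.continuous_re.comp ρ.continuous_of_finiteDimensional
  obtain ⟨c, hc, hmin⟩ := hT.exists_forall_le' hcont.continuousOn (a := 0) fun A hA =>
    (Complex.lt_def.1 (hρ.2 A hA.1.1 (by rintro rfl; simpa using hA.2))).1
  refine ⟨c, hc, fun A hA => ?_⟩
  have ht : 0 ≤ A.trace.re := (Complex.le_def.1 hA.trace_nonneg).1
  rcases ht.eq_or_lt with h0 | hpos
  · simpa [← h0] using (Complex.le_def.1 (hρ.1 A hA)).1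
  · have hB : (((A.trace.re⁻¹ : ℝ) : ℂ) • A).PosSemidef :=
      hA.smul (Complex.zero_le_real.2 (inv_nonneg.2 ht))
    have htrB : (((A.trace.re⁻¹ : ℝ) : ℂ) • A).trace.re = 1 := by
      rw [Matrix.trace_smul, smul_eq_mul, Complex.re_ofReal_mul, inv_mul_cancel₀ hpos.ne']
    have h := hmin _ ⟨⟨hB, htrB.le⟩, htrB⟩
    rw [map_smul, smul_eq_mul, Complex.re_ofReal_mul, ← div_eq_inv_mul] at h
    exact (le_div_iff₀ hpos).1 h

section Slice

variable {m n l : ℕ}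

/-- The partial trace over `M_m(ℂ) ⊗ M_n(ℂ)^{⊗ l}`, keeping the last tensor factor. -/
def partialTrace (y : Mat m n (l + 1)) : Matrix (Fin n) (Fin n) ℂ :=
  ∑ a : Fin m × (Fin l → Fin n),
    y.submatrix (fun s => (a.1, Fin.snoc a.2 s)) fun s => (a.1, Fin.snoc a.2 s)

theorem posSemidef_partialTrace {y : Mat m n (l + 1)} (hy : y.PosSemidef) :
    (partialTrace y).PosSemidef :=
  Matrix.posSemidef_sum _ fun _ _ => hy.submatrix _

theorem trace_partialTrace (y : Mat m n (l + 1)) : (partialTrace y).trace = y.trace := by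
  rw [partialTrace, Matrix.trace_sum, Matrix.trace]
  simp only [Fintype.sum_prod_type]
  refine Finset.sum_congr rfl fun p _ => ?_
  refine Eq.trans ?_ ((Fin.snocEquiv fun _ : Fin (l + 1) => Fin n).sum_comp
    fun i => y (p, i) (p, i))
  rw [Fintype.sum_prod_type_right]
  rfl

theorem trace_sliceMap (ρ : Matrix (Fin n) (Fin n) ℂ →ₗ[ℂ] ℂ) (y : Mat m n (l + 1)) :
    (sliceMap ρ y).trace = ρ (partialTrace y) := by
  rw [partialTrace, map_sum]
  rfl

theorem continuous_sliceMap (ρ : Matrix (Fin n) (Fin n) ℂ →ₗ[ℂ] ℂ) :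
    Continuous (sliceMap ρ : Mat m n (l + 1) → Mat m n l) := by
  refine continuous_pi fun a => continuous_pi fun b => ?_
  refine ρ.continuous_of_finiteDimensional.comp (continuous_pi fun s => continuous_pi fun t => ?_)
  exact continuous_id.matrix_elem _ _

end Slice

theorem isClosed_symInvariant {m n l : ℕ} : IsClosed {x : Mat m n l | SymInvariant x} := by
  simp only [SymInvariant, Set.ofPred_forall]
  refine isClosed_iInter fun σ => isClosed_iInter fun p => isClosed_iInter fun q =>
    isClosed_iInter fun i => isClosed_iInter fun j => ?_
  exact isClosed_eq (continuous_id.matrix_elem _ _) (continuous_id.matrix_elem _ _)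

theorem isClosed_Kcone (m n : ℕ) (ρ : Matrix (Fin n) (Fin n) ℂ →ₗ[ℂ] ℂ) :
    IsClosed (Kcone m n ρ) := by
  have happ (l : ℕ) : Continuous fun x : ∀ l : ℕ, Mat m n l => x l := continuous_apply l
  simp only [Kcone, Set.ofPred_and, Set.ofPred_forall]
  refine (isClosed_iInter fun l => ?_).inter
    ((isClosed_iInter fun l => ?_).inter (isClosed_iInter fun l => ?_))
  · exact isClosed_posSemidef.preimage (happ l)
  · exact isClosed_symInvariant.preimage (happ l)
  · exact isClosed_posSemidef.preimage
      ((happ l).sub ((continuous_sliceMap ρ).comp (happ (l + 1))))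

theorem trace_re_le_of_mem_Kcone {m n : ℕ} {ρ : Matrix (Fin n) (Fin n) ℂ →ₗ[ℂ] ℂ} {c : ℝ}
    (hc : 0 < c) (hρ : ∀ A : Matrix (Fin n) (Fin n) ℂ, A.PosSemidef →
      c * A.trace.re ≤ (ρ A).re)
    {x : ∀ l : ℕ, Mat m n l} (hx : x ∈ Kcone m n ρ) (l : ℕ) :
    (x l).trace.re ≤ (x 0).trace.re / c ^ l := by
  induction l with
  | zero => simp
  | succ l ih =>
    have h1 := hρ _ (posSemidef_partialTrace (hx.1 (l + 1)))
    rw [trace_partialTrace, ← trace_sliceMap] at h1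
    have h2 := (Complex.le_def.1 (hx.2.2 l).trace_nonneg).1
    rw [Matrix.trace_sub, Complex.sub_re, Complex.zero_re] at h2
    rw [pow_succ, ← div_div, le_div_iff₀ hc]
    linarith

theorem stmt0 (m n : ℕ) (hm : 0 < m) (hn : 0 < n)
    (ρ : Matrix (Fin n) (Fin n) ℂ →ₗ[ℂ] ℂ) (hρ : IsFaithfulPosLF ρ)
    (r : ℝ) (hr : 0 < r) :
    IsCompact {x : ∀ l : ℕ, Mat m n l |
      x ∈ Kcone m n ρ ∧ (x 0).trace ≤ (r : ℂ)} := by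
  obtain ⟨c, hc, hρc⟩ := hρ.exists_mul_trace_le
  refine (isCompact_univ_pi fun l =>
    isCompact_posSemidef_trace_le (r / c ^ l)).of_isClosed_subset ?_ fun x hx l _ => ⟨hx.1.1 l, ?_⟩
  · have htr : Continuous fun x : ∀ l : ℕ, Mat m n l => (x 0).trace :=
      (continuous_apply 0).matrix_trace
    have hle : IsClosed {x : ∀ l : ℕ, Mat m n l | (x 0).trace ≤ (r : ℂ)} :=
      isClosed_le htr continuous_const
    exact (isClosed_Kcone m n ρ).inter hle
  · refine (trace_re_le_of_mem_Kcone hc hρc hx.1 l).trans ?_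
    gcongr
    exact (Complex.le_def.1 hx.2).1

end DeFinetti
end

section
/- Let m, n be positive integers, ρ a faithful positive linear functional on M_n(ℂ), and x = (x_l)_{l≥0} ∈ K_{m,ρ}. For any positive linear functional ν on M_n(ℂ), define x_ν = (x_{ν,l})_{l≥0} by x_{ν,l} := (id_m ⊗ id_n^{⊗l} ⊗ ν)(x_{l+1}). Then x_ν ∈ K_{m,ρ}; moreover, if ν ≤ ρ (i.e. ρ − ν is a positive functional), then x_{ν,l} ≤ x_l for every l ≥ 0. (Claim established in the proof of Theorem 3.3.) -/
open scoped ComplexOrder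

namespace DeFinetti

lemma sliceMap_sub_right {m n l : ℕ} (ν : Matrix (Fin n) (Fin n) ℂ →ₗ[ℂ] ℂ)
    (y z : Mat m n (l + 1)) :
    sliceMap ν (y - z) = sliceMap ν y - sliceMap ν z := by
  ext a b
  exact map_sub ν _ _

lemma sliceMap_sub_left {m n l : ℕ} (ρ ν : Matrix (Fin n) (Fin n) ℂ →ₗ[ℂ] ℂ)
    (y : Mat m n (l + 1)) :
    sliceMap (ρ - ν) y = sliceMap ρ y - sliceMap ν y := rfl

/-- Over `ℂ`, nonnegativity of the quadratic form already forces a matrix to be Hermitian. -/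
lemma posSemidef_of_forall_nonneg {ι : Type*} [Fintype ι] {M : Matrix ι ι ℂ}
    (h : ∀ z : ι → ℂ, 0 ≤ star z ⬝ᵥ (M.mulVec z)) : M.PosSemidef := by
  classical
  refine .of_dotProduct_mulVec_nonneg ?_ h
  rw [← Matrix.isSymmetric_toEuclideanLin_iff, LinearMap.isSymmetric_iff_inner_map_self_real]
  intro v
  have hv := h (WithLp.ofLp v)
  rw [RCLike.conj_eq_iff_im]
  have hi := (Complex.nonneg_iff.mp hv).2
  rw [← inner_conj_symm]
  simpa [EuclideanSpace.inner_eq_star_dotProduct, dotProduct_comm] using hi.symm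

/-- Functionals applied to different pairs of indices of an array commute. -/
lemma map_map_comm {n : ℕ} (ρ ν : Matrix (Fin n) (Fin n) ℂ →ₗ[ℂ] ℂ)
    (F : Fin n → Fin n → Fin n → Fin n → ℂ) :
    ρ (Matrix.of fun s t => ν (Matrix.of fun u v => F s t u v)) =
      ν (Matrix.of fun u v => ρ (Matrix.of fun s t => F s t u v)) := by
  have hsum (μ : Matrix (Fin n) (Fin n) ℂ →ₗ[ℂ] ℂ) (f : Fin n → Fin n → ℂ) :
      μ (Matrix.of f) = ∑ a : Fin n × Fin n, f a.1 a.2 * μ (Matrix.single a.1 a.2 1) := by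
    conv_lhs => rw [Matrix.matrix_eq_sum_single (Matrix.of f)]
    simp only [map_sum, Fintype.sum_prod_type]
    refine Finset.sum_congr rfl fun s _ => Finset.sum_congr rfl fun t _ => ?_
    rw [← smul_eq_mul, ← map_smul, Matrix.smul_single, smul_eq_mul, mul_one, Matrix.of_apply]
  simp only [hsum, Finset.sum_mul]
  rw [Finset.sum_comm]
  exact Finset.sum_congr rfl fun _ _ => Finset.sum_congr rfl fun _ _ => mul_right_comm _ _ _

/-- Slicing by a positive functional preserves positivity. -/
lemma sliceMap_posSemidef {m n l : ℕ} {ν : Matrix (Fin n) (Fin n) ℂ →ₗ[ℂ] ℂ}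
    (hν : IsPosLF ν) {y : Mat m n (l + 1)} (hy : y.PosSemidef) :
    (sliceMap ν y).PosSemidef := by
  refine posSemidef_of_forall_nonneg fun z => ?_
  let e : (Fin m × (Fin l → Fin n)) × Fin n → Fin m × (Fin (l + 1) → Fin n) :=
    fun a => (a.1.1, Fin.snoc (α := fun _ => Fin n) a.1.2 a.2)
  let B : Matrix ((Fin m × (Fin l → Fin n)) × Fin n) (Fin n) ℂ :=
    Matrix.of fun a s => if a.2 = s then z a.1 else 0
  have key : star z ⬝ᵥ ((sliceMap ν y).mulVec z) =
      ν (B.conjTranspose * y.submatrix e e * B) := by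
    have hB : B.conjTranspose * y.submatrix e e * B =
        ∑ a, ∑ b, (star (z a) * z b) •
          (Matrix.of fun s t => y (e (a, s)) (e (b, t))) := by
      have hsum (t : Fin n) (f : (Fin m × (Fin l → Fin n)) × Fin n → ℂ) :
          (∑ a, if a.2 = t then f a else 0) = ∑ a, f (a, t) := by
        rw [Fintype.sum_prod_type]
        simp
      ext s t
      simp only [Matrix.mul_apply, Matrix.sum_apply, Matrix.smul_apply, Matrix.of_apply,
        Matrix.conjTranspose_apply, Matrix.submatrix_apply, B, apply_ite star, star_zero,
        ite_mul, mul_ite, zero_mul, mul_zero, hsum, smul_eq_mul, Finset.sum_mul]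
      rw [Finset.sum_comm]
      exact Finset.sum_congr rfl fun a _ => Finset.sum_congr rfl fun b _ =>
        mul_right_comm _ _ _
    rw [hB]
    simp only [map_sum, map_smul, dotProduct, Matrix.mulVec, Finset.mul_sum, smul_eq_mul,
      Pi.star_apply]
    refine Finset.sum_congr rfl fun a _ => Finset.sum_congr rfl fun b _ => ?_
    simp only [sliceMap, e]
    ring
  rw [key]
  exact hν _ ((hy.submatrix e).conjTranspose_mul_mul_same B)

/-- Slicing preserves symmetry in the remaining tensor factors. -/
lemma SymInvariant.sliceMap {m n l : ℕ} (ν : Matrix (Fin n) (Fin n) ℂ →ₗ[ℂ] ℂ)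
    {y : Mat m n (l + 1)} (hy : SymInvariant y) :
    SymInvariant (DeFinetti.sliceMap ν y) := by
  intro σ p q i j
  let τ : Equiv.Perm (Fin (l + 1)) :=
    (finSuccEquivLast.trans σ.optionCongr).trans finSuccEquivLast.symm
  have hτ (i : Fin l → Fin n) (s : Fin n) :
      (Fin.snoc (α := fun _ => Fin n) (i ∘ σ) s) =
        (Fin.snoc (α := fun _ => Fin n) i s) ∘ τ := by
    funext k
    refine Fin.lastCases ?_ (fun k => ?_) k <;> simp [τ]
  simp only [DeFinetti.sliceMap, hτ, hy τ]

/-- Slices by two functionals commute on symmetric matrices. -/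
lemma sliceMap_comm {m n l : ℕ} (ρ ν : Matrix (Fin n) (Fin n) ℂ →ₗ[ℂ] ℂ)
    {y : Mat m n (l + 1 + 1)} (hy : SymInvariant y) :
    sliceMap ρ (sliceMap ν y) = sliceMap ν (sliceMap ρ y) := by
  have hswap (i : Fin l → Fin n) (s u : Fin n) :
      Fin.snoc (α := fun _ => Fin n) (Fin.snoc (α := fun _ => Fin n) i s) u ∘
          Equiv.swap (Fin.last (l + 1)) (Fin.last l).castSucc =
        Fin.snoc (α := fun _ => Fin n) (Fin.snoc (α := fun _ => Fin n) i u) s := by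
    funext k
    refine Fin.lastCases ?_ (fun k => Fin.lastCases ?_ (fun k => ?_) k) k
    · simp
    · simp
    · have h₁ : k.castSucc.castSucc ≠ Fin.last (l + 1) := (Fin.castSucc_lt_last _).ne
      have h₂ : k.castSucc.castSucc ≠ (Fin.last l).castSucc := by simp
      simp [Equiv.swap_apply_of_ne_of_ne h₁ h₂]
  ext ⟨p, i⟩ ⟨q, j⟩
  simp only [sliceMap]
  rw [map_map_comm ρ ν fun s t u v =>
    y (p, Fin.snoc (Fin.snoc i s) u) (q, Fin.snoc (Fin.snoc j t) v)]
  congr! 5 with u v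
  ext s t
  rw [Matrix.of_apply, Matrix.of_apply, ← hswap i s u, ← hswap j t v, hy]

theorem stmt5 (m n : ℕ) (hm : 0 < m) (hn : 0 < n)
    (ρ ν : Matrix (Fin n) (Fin n) ℂ →ₗ[ℂ] ℂ)
    (hρ : IsFaithfulPosLF ρ) (hν : IsPosLF ν)
    (x : ∀ l : ℕ, Mat m n l) (hx : x ∈ Kcone m n ρ) :
    (fun l => sliceMap ν (x (l + 1))) ∈ Kcone m n ρ ∧
    (IsPosLF (ρ - ν) → ∀ l, (x l - sliceMap ν (x (l + 1))).PosSemidef) := by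
  obtain ⟨hpos, hsym, hmart⟩ := hx
  refine ⟨⟨fun l => sliceMap_posSemidef hν (hpos _), fun l => (hsym _).sliceMap ν, fun l => ?_⟩,
    fun hle l => ?_⟩
  · rw [sliceMap_comm ρ ν (hsym _), ← sliceMap_sub_right]
    exact sliceMap_posSemidef hν (hmart _)
  · have h := (hmart l).add (sliceMap_posSemidef hle (hpos (l + 1)))
    rwa [sliceMap_sub_left, sub_add_sub_cancel] at h

end DeFinetti
end

section
/- Let m, n be positive integers, l ≥ 1 an integer, ρ and ν positive linear functionals on M_n(ℂ), and r > 0 with rν ≤ ρ (i.e. ρ − rν is a positive functional). If y is an l-sub-extension of a positive semidefinite a ∈ M_m(ℂ)⊗M_n(ℂ) with respect to ρ, then r^{l−1}·y is an l-sub-extension of a with respect to ν. (Claim in the proof of Theorem 3.5, establishing the equivalence of conditions (2) and (3) there.) -/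
open scoped ComplexOrder

namespace DeFinetti

/-- A square complex matrix whose quadratic form is nonnegative is positive semidefinite. -/
theorem posSemidef_of_dotProduct_nonneg {I : Type*} [Fintype I] [DecidableEq I]
    {M : Matrix I I ℂ} (h : ∀ x : I → ℂ, 0 ≤ star x ⬝ᵥ M.mulVec x) : M.PosSemidef := by
  rw [← Matrix.isPositive_toEuclideanLin_iff, LinearMap.isPositive_iff_complex]
  intro x
  have hx := Complex.nonneg_iff.mp (h x.ofLp)
  have he : inner ℂ (M.toEuclideanLin x) x = star (star x.ofLp ⬝ᵥ M.mulVec x.ofLp) := by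
    rw [EuclideanSpace.inner_eq_star_dotProduct, Matrix.ofLp_toLpLin, Matrix.toLin'_apply,
      ← Matrix.star_dotProduct, dotProduct_comm]
  rw [he]
  exact ⟨Complex.ext (by simp) (by simp [← hx.2]), by simpa using hx.1⟩

/-- The slice `id ⊗ φ` of a matrix over a product index type. -/
def slice {I J : Type*} (φ : Matrix J J ℂ →ₗ[ℂ] ℂ) (Y : Matrix (I × J) (I × J) ℂ) :
    Matrix I I ℂ :=
  Matrix.of fun i j => φ (Matrix.of fun s t => Y (i, s) (j, t))

/-- Positive functionals are completely positive. -/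
theorem posSemidef_slice {I : Type*} [Fintype I] {n : ℕ}
    {φ : Matrix (Fin n) (Fin n) ℂ →ₗ[ℂ] ℂ} (hφ : IsPosLF φ)
    {Y : Matrix (I × Fin n) (I × Fin n) ℂ} (hY : Y.PosSemidef) : (slice φ Y).PosSemidef := by
  classical
  refine posSemidef_of_dotProduct_nonneg fun x => ?_
  let B : Matrix (I × Fin n) (Fin n) ℂ := Matrix.of fun p t => if p.2 = t then x p.1 else 0
  have hB : star x ⬝ᵥ (slice φ Y).mulVec x = φ (B.conjTranspose * Y * B) := by
    have : B.conjTranspose * Y * B = ∑ i, ∑ j, (star (x i) * x j) •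
        (Matrix.of fun s t => Y (i, s) (j, t) : Matrix (Fin n) (Fin n) ℂ) := by
      ext s t
      simp only [Matrix.mul_apply, Matrix.conjTranspose_apply, B, Matrix.of_apply,
        Fintype.sum_prod_type, Matrix.sum_apply, Matrix.smul_apply, apply_ite star, star_zero,
        ite_mul, mul_ite, zero_mul, mul_zero, Finset.sum_ite_eq', Finset.mem_univ, if_true,
        Finset.sum_mul, smul_eq_mul]
      rw [Finset.sum_comm]
      exact Finset.sum_congr rfl fun i _ => Finset.sum_congr rfl fun j _ => by ring
    rw [this]
    simp only [map_sum, map_smul, dotProduct, Matrix.mulVec, slice, Matrix.of_apply, Pi.star_apply,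
      Finset.mul_sum, smul_eq_mul]
    exact Finset.sum_congr rfl fun i _ => Finset.sum_congr rfl fun j _ => by ring
  rw [hB]
  exact hφ _ (hY.conjTranspose_mul_mul_same B)

/-- If `r ν ≤ ρ`, `0 ≤ Z` and `d Z' ≤ Z`, then
`d r ^ k (id ⊗ ν^{⊗ k})(Z') ≤ (id ⊗ ρ^{⊗ k})(Z)`. -/
theorem posSemidef_powFun_sub {I : Type*} [Fintype I] {n : ℕ}
    {ρ ν : Matrix (Fin n) (Fin n) ℂ →ₗ[ℂ] ℂ} (hρ : IsPosLF ρ) (hν : IsPosLF ν)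
    {r : ℝ} (hr : 0 ≤ r) (hrνρ : IsPosLF (ρ - (r : ℂ) • ν)) (k : ℕ) (d : ℝ)
    (Z Z' : Matrix (I × (Fin k → Fin n)) (I × (Fin k → Fin n)) ℂ) (hZ : Z.PosSemidef)
    (hZZ' : (Z - (d : ℂ) • Z').PosSemidef) :
    (Matrix.of fun i j => powFun ρ k (Matrix.of fun s t => Z (i, s) (j, t)) -
      (d * r ^ k : ℂ) * powFun ν k (Matrix.of fun s t => Z' (i, s) (j, t)) :
      Matrix I I ℂ).PosSemidef := by
  induction k generalizing d with
  | zero =>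
    convert hZZ'.submatrix fun i : I => (i, fun u : Fin 0 => u.elim0) using 1
    ext i j
    simp [powFun]
  | succ k ih =>
    let e : (I × (Fin k → Fin n)) × Fin n → I × (Fin (k + 1) → Fin n) :=
      fun p => (p.1.1, Fin.snoc p.1.2 p.2)
    have h := ih (d * r) (slice ρ (Z.submatrix e e)) (slice ν (Z'.submatrix e e))
      (posSemidef_slice hρ (hZ.submatrix e)) (by
        convert (posSemidef_slice hrνρ (hZ.submatrix e)).add
          ((posSemidef_slice hν (hZZ'.submatrix e)).smul
            (Complex.zero_le_real.mpr hr)) using 1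
        ext p q
        have hs : (Matrix.of fun s t => (Z - (d : ℂ) • Z').submatrix e e (p, s) (q, t)) =
            (Matrix.of fun s t => Z.submatrix e e (p, s) (q, t)) -
              (d : ℂ) • (Matrix.of fun s t => Z'.submatrix e e (p, s) (q, t) :
                Matrix (Fin n) (Fin n) ℂ) := rfl
        simp only [slice, Matrix.sub_apply, Matrix.add_apply, Matrix.smul_apply, Matrix.of_apply,
          hs, map_sub, map_smul, LinearMap.sub_apply, LinearMap.smul_apply, smul_eq_mul]
        push_cast
        ring)
    convert h using 1
    ext i j
    simp only [powFun, Matrix.of_apply, slice, Matrix.submatrix_apply, e]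
    push_cast
    ring

theorem stmt7 (m n : ℕ) (hm : 0 < m) (hn : 0 < n) (k : ℕ)
    (ρ ν : Matrix (Fin n) (Fin n) ℂ →ₗ[ℂ] ℂ)
    (hρ : IsPosLF ρ) (hν : IsPosLF ν)
    (r : ℝ) (hr : 0 < r) (hrνρ : IsPosLF (ρ - (r : ℂ) • ν))
    (a : Matrix (Fin m × Fin n) (Fin m × Fin n) ℂ) (ha : a.PosSemidef)
    (y : Mat m n (k + 1)) (hy : IsSubExtension ρ a y) :
    IsSubExtension ν a ((r ^ k : ℝ) • y) := by
  obtain ⟨hy, hsymm, hay⟩ := hy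
  have hrk : 0 < r ^ k := pow_pos hr k
  refine ⟨hy.smul hrk.le, fun σ p q i j => ?_, ?_⟩
  · simp only [Matrix.smul_apply, hsymm σ p q i j]
  let e : (Fin m × Fin n) × (Fin k → Fin n) → Fin m × (Fin (k + 1) → Fin n) :=
    fun p => (p.1.1, Fin.cons p.1.2 p.2)
  have hrk' : ((r : ℂ) ^ k) ≠ 0 := by exact_mod_cast hrk.ne'
  have h := posSemidef_powFun_sub hρ hν hr.le hrνρ k (r ^ k)⁻¹ (y.submatrix e e)
    (((r ^ k : ℝ) • y).submatrix e e) (hy.submatrix e) (by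
      convert Matrix.PosSemidef.zero using 1
      ext p q
      simp [hrk'])
  convert hay.add h using 1
  ext ps qt
  simp [subSlice, e, hrk']

end DeFinetti
end
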